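/- (Global solvability) Let P be a topological space, (X,d) a complete metric space, Y a normed vector space, F : P×X ⇉ Y with F(p,x) nonempty and closed for every (p,x), and C : P ⇉ Y with each C(p) a closed convex cone satisfying {0} ≠ C(p) ⊊ Y. Suppose that: (i) for every p ∈ P there exists x̂_p ∈ X with e(F(p,x̂_p), C(p)) < +∞; (ii) F(p,·) : X ⇉ Y is lower semicontinuous on X for every p ∈ P; (iii) α_{F,C} > 1. Then for every α ∈ (1, α_{F,C}), every x₀ ∈ X and every p ∈ P it holds S(p) ≠ ∅ and dist(x₀, S(p)) ≤ e(F(p,x₀), C(p))/(α−1). -/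

import Mathlib

open Set Metric EMetric ENNReal Pointwise Filter Topology

/-- Excess of `A` beyond `B`: `e(A,B) = ⨆ a ∈ A, dist(a,B)` in `[0,∞]`. -/
noncomputable def excess {Y : Type*} [PseudoEMetricSpace Y] (A B : Set Y) : ℝ≥0∞ :=
  ⨆ a ∈ A, EMetric.infEdist a B

/-- `C` is a closed convex cone (containing the origin). -/
def IsClosedConvexCone {Y : Type*} [SeminormedAddCommGroup Y] [NormedSpace ℝ Y]
    (C : Set Y) : Prop :=
  IsClosed C ∧ Convex ℝ C ∧ (0 : Y) ∈ C ∧ ∀ c ∈ C, ∀ t : ℝ, 0 ≤ t → t • c ∈ C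

/-- `a` is an admissible bound of metric `C`-increase of `G` at `x₀`. -/
def IsIncBoundAt {X Y : Type*} [PseudoMetricSpace X] [SeminormedAddCommGroup Y]
    (G : X → Set Y) (C : Set Y) (x₀ : X) (a : ℝ) : Prop :=
  1 < a ∧ ∃ δ : ℝ, 0 < δ ∧ ∀ r : ℝ, 0 < r → r ≤ δ →
    ∃ u ∈ Metric.closedBall x₀ r,
      Metric.cthickening (a * r) (G u) ⊆ Metric.cthickening r (G x₀ + C)

/-- `G` is metrically `C`-increasing at `x₀`. -/
def CIncreasingAt {X Y : Type*} [PseudoMetricSpace X] [SeminormedAddCommGroup Y]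
    (G : X → Set Y) (C : Set Y) (x₀ : X) : Prop :=
  ∃ a : ℝ, IsIncBoundAt G C x₀ a

/-- The exact bound of metric `C`-increase of `G` at `x₀` (in `[0,∞]`). -/
noncomputable def incBound {X Y : Type*} [PseudoMetricSpace X] [SeminormedAddCommGroup Y]
    (G : X → Set Y) (C : Set Y) (x₀ : X) : ℝ≥0∞ :=
  ⨆ a ∈ {a : ℝ | IsIncBoundAt G C x₀ a}, ENNReal.ofReal a

/-- Lower semicontinuity of a set-valued mapping. -/
def LscSV {P Y : Type*} [TopologicalSpace P] [TopologicalSpace Y] (G : P → Set Y) : Prop :=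
  ∀ p : P, ∀ A : Set Y, IsOpen A → (G p ∩ A).Nonempty →
    ∀ᶠ p' in nhds p, (G p' ∩ A).Nonempty

/-- Upper semicontinuity of a set-valued mapping. -/
def UscSV {P Y : Type*} [TopologicalSpace P] [TopologicalSpace Y] (G : P → Set Y) : Prop :=
  ∀ p : P, ∀ A : Set Y, IsOpen A → G p ⊆ A → ∀ᶠ p' in nhds p, G p' ⊆ A

/-- Hausdorff `C`-upper semicontinuity at a point. -/
def HausdorffCUscAt {P Y : Type*} [TopologicalSpace P] [SeminormedAddCommGroup Y]
    (G : P → Set Y) (C : Set Y) (p₀ : P) : Prop :=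
  ∀ ε : ℝ, 0 < ε → ∀ᶠ p in nhds p₀, G p ⊆ Metric.cthickening ε (G p₀ + C)

/-- `C`-concavity of a set-valued mapping. -/
def CConcave {X Y : Type*} [SeminormedAddCommGroup X] [NormedSpace ℝ X]
    [SeminormedAddCommGroup Y] [NormedSpace ℝ Y] (G : X → Set Y) (C : Set Y) : Prop :=
  ∀ x₁ x₂ : X, ∀ t : ℝ, t ∈ Set.Icc (0:ℝ) 1 →
    G (t • x₁ + (1 - t) • x₂) ⊆ t • G x₁ + (1 - t) • G x₂ + C

/-- A set is proximinal if the distance to it is attained from every point. -/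
def Proximinal {X : Type*} [PseudoMetricSpace X] (S : Set X) : Prop :=
  ∀ x : X, ∃ s ∈ S, dist x s = Metric.infDist x S

/-- Metric (Menger) convexity of a metric space. -/
def MetricallyConvex (X : Type*) [PseudoMetricSpace X] : Prop :=
  ∀ a b : X, a ≠ b → ∃ c : X, c ≠ a ∧ c ≠ b ∧ dist a b = dist a c + dist c b

/-- The constant `α_{F,C}` associated with a parameterized set-valued inclusion. -/
noncomputable def alphaFC {P X Y : Type*} [PseudoMetricSpace X] [SeminormedAddCommGroup Y]
    (F : P → X → Set Y) (Cm : P → Set Y) : ℝ≥0∞ :=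
  ⨅ q ∈ {q : P × X | ¬ (F q.1 q.2 ⊆ Cm q.1)}, incBound (F q.1) (Cm q.1) q.2

/-- The constant `α̃_{F,C,R}` associated with a constrained set-valued inclusion. -/
noncomputable def alphaTilde {P X Y : Type*} [PseudoMetricSpace X] [SeminormedAddCommGroup Y]
    (F : P → X → Set Y) (Cm : P → Set Y) (R : P → Set X) : ℝ≥0∞ :=
  ⨅ q ∈ {q : P × X | ¬ (F q.1 q.2 ⊆ Cm q.1) ∧ q.2 ∈ R q.1}, incBound (F q.1) (Cm q.1) q.2

/-- The exact bound of `C`-decrease of a single-valued map: `dec(g,C,x₀) = inc(−g,C,x₀)`. -/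
noncomputable def decBound {X Y : Type*} [PseudoMetricSpace X] [SeminormedAddCommGroup Y]
    (g : X → Y) (C : Set Y) (x₀ : X) : ℝ≥0∞ :=
  incBound (fun x => ({-g x} : Set Y)) C x₀

/-- `g` is `C`-decreasing at `x₀` iff `−g` is `C`-increasing there. -/
def CDecreasingAt {X Y : Type*} [PseudoMetricSpace X] [SeminormedAddCommGroup Y]
    (g : X → Y) (C : Set Y) (x₀ : X) : Prop :=
  CIncreasingAt (fun x => ({-g x} : Set Y)) C x₀

/-- **Ekeland's variational principle**, in the form of the existence of a minimal point for the
order induced by a lower semicontinuous function. -/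
theorem LowerSemicontinuous.exists_ekeland {X : Type*} [MetricSpace X] [CompleteSpace X]
    {φ : X → ℝ≥0∞} (hφ : LowerSemicontinuous φ) {c : ℝ≥0∞} (hc : c ≠ 0) (hc' : c ≠ ⊤)
    {x₀ : X} (hx₀ : φ x₀ ≠ ⊤) :
    ∃ z, φ z + c * edist x₀ z ≤ φ x₀ ∧ ∀ u, φ u + c * edist z u ≤ φ z → u = z := by
  let T : X → Set X := fun x => {u | φ u + c * edist x u ≤ φ x}
  have self_mem : ∀ x, x ∈ T x := fun x => by simp [T]
  have trans : ∀ {x y}, y ∈ T x → T y ⊆ T x := by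
    intro x y hy u hu
    calc φ u + c * edist x u ≤ φ u + c * (edist x y + edist y u) := by
          gcongr; exact edist_triangle _ _ _
      _ = (φ u + c * edist y u) + c * edist x y := by ring
      _ ≤ φ y + c * edist x y := by gcongr; exact hu
      _ ≤ φ x := hy
  have closed : ∀ x, IsClosed (T x) := by
    intro x
    have hcont : Continuous fun u => c * edist x u :=
      (ENNReal.continuous_const_mul hc').comp (continuous_const.edist continuous_id)
    exact (hφ.add hcont.lowerSemicontinuous).isClosed_preimage (φ x)
  have step : ∀ (n : ℕ) (x : X), ∃ y ∈ T x, φ x ≠ ⊤ →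
      ∀ u ∈ T x, φ y ≤ φ u + (2⁻¹ : ℝ≥0∞) ^ n := by
    intro n x
    by_cases hx : φ x = ⊤
    · exact ⟨x, self_mem x, fun h => (h hx).elim⟩
    have hle : ⨅ u ∈ T x, φ u ≤ φ x := iInf₂_le x (self_mem x)
    have hlt : ⨅ u ∈ T x, φ u < (⨅ u ∈ T x, φ u) + (2⁻¹ : ℝ≥0∞) ^ n :=
      ENNReal.lt_add_right (ne_top_of_le_ne_top hx hle) (by simp)
    obtain ⟨y, hy, hylt⟩ : ∃ y, ∃ _ : y ∈ T x, φ y < (⨅ u ∈ T x, φ u) + (2⁻¹ : ℝ≥0∞) ^ n := by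
      simpa only [iInf_lt_iff] using hlt
    exact ⟨y, hy, fun _ u hu => hylt.le.trans (by gcongr; exact iInf₂_le u hu)⟩
  choose next next_mem next_le using step
  let s : ℕ → X := fun n => Nat.rec x₀ next n
  have s_succ : ∀ n, s (n + 1) ∈ T (s n) := fun n => next_mem n (s n)
  have s_mem : ∀ {n m}, n ≤ m → s m ∈ T (s n) := by
    intro n m h
    induction m, h using Nat.le_induction with
    | base => exact self_mem _
    | succ m _ ih => exact trans ih (s_succ m)
  have T_le : ∀ {x u}, u ∈ T x → φ u ≤ φ x := fun h => le_self_add.trans h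
  have s_fin : ∀ n, φ (s n) ≠ ⊤ := fun n =>
    ne_top_of_le_ne_top hx₀ (T_le (s_mem (Nat.zero_le n)))
  have small : ∀ n, ∀ u ∈ T (s (n + 1)), edist (s (n + 1)) u ≤ (2⁻¹ : ℝ≥0∞) ^ n / c := by
    intro n u hu
    have hfin : φ u ≠ ⊤ := ne_top_of_le_ne_top (s_fin (n + 1)) (T_le hu)
    have h1 : φ u + c * edist (s (n + 1)) u ≤ φ u + (2⁻¹ : ℝ≥0∞) ^ n :=
      le_trans hu (next_le n (s n) (s_fin n) u (trans (s_succ n) hu))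
    rw [ENNReal.le_div_iff_mul_le (Or.inl hc) (Or.inl hc'), mul_comm]
    exact (ENNReal.add_le_add_iff_left hfin).1 h1
  have lim0 : Tendsto (fun n : ℕ => (2⁻¹ : ℝ≥0∞) ^ n / c) atTop (𝓝 0) := by
    have h := ENNReal.Tendsto.div_const (b := c)
      (ENNReal.tendsto_pow_atTop_nhds_zero_of_lt_one (r := 2⁻¹) (by simp)) (Or.inr hc)
    simpa using h
  have cau : CauchySeq fun n => s (n + 1) := by
    refine EMetric.cauchySeq_iff'.2 fun ε hε => ?_
    obtain ⟨N, hN⟩ := (lim0.eventually_lt_const hε).exists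
    refine ⟨N, fun n hn => ?_⟩
    rw [edist_comm]
    exact (small N _ (s_mem (n := N + 1) (m := n + 1) (by omega))).trans_lt hN
  obtain ⟨z, hz⟩ := cauchySeq_tendsto_of_complete cau
  have z_mem : ∀ n, z ∈ T (s n) := fun n =>
    (closed _).mem_of_tendsto hz
      ((eventually_ge_atTop n).mono fun m hm => s_mem (n := n) (m := m + 1) (by omega))
  refine ⟨z, z_mem 0, fun u hu => ?_⟩
  have hu' : Tendsto (fun n => s (n + 1)) atTop (𝓝 u) :=
    tendsto_iff_edist_tendsto_0.2 (tendsto_of_tendsto_of_tendsto_of_le_of_le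
      tendsto_const_nhds lim0 (fun _ => zero_le) fun n => small n u (trans (z_mem (n + 1)) hu))
  exact tendsto_nhds_unique hu' hz

theorem LscSV.lowerSemicontinuous_excess {X Y : Type*} [TopologicalSpace X]
    [PseudoEMetricSpace Y] {G : X → Set Y} (hG : LscSV G) (C : Set Y) :
    LowerSemicontinuous fun x => excess (G x) C := by
  intro x y hy
  simp only [excess, lt_iSup_iff] at hy
  obtain ⟨a, ha, hya⟩ := hy
  have hopen : IsOpen {a : Y | y < infEDist a C} :=
    isOpen_lt continuous_const continuous_infEDist
  filter_upwards [hG x _ hopen ⟨a, ha, hya⟩] with x' ⟨b, hb, hyb⟩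
  simp only [excess, lt_iSup_iff]
  exact ⟨b, hb, hyb⟩

theorem infEDist_le_excess {Y : Type*} [PseudoEMetricSpace Y] {A : Set Y} (C : Set Y) {a : Y}
    (ha : a ∈ A) : infEDist a C ≤ excess A C :=
  le_iSup₂ (f := fun a (_ : a ∈ A) => infEDist a C) a ha

theorem excess_eq_zero_iff {Y : Type*} [PseudoEMetricSpace Y] {A C : Set Y} (hC : IsClosed C) :
    excess A C = 0 ↔ A ⊆ C := by
  simp only [excess, ENNReal.iSup_eq_zero]
  exact forall₂_congr fun a _ => (mem_iff_infEDist_zero_of_closed hC).symm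

theorem Convex.infDist_le_infDist_add_smul_sub {Y : Type*} [SeminormedAddCommGroup Y]
    [NormedSpace ℝ Y] {C : Set Y} (hC : Convex ℝ C) {c : Y} (hc : c ∈ C) (y : Y) {t : ℝ}
    (ht : 0 ≤ t) : (1 + t) * infDist y C ≤ infDist (y + t • (y - c)) C := by
  refine (le_infDist ⟨c, hc⟩).2 fun c' hc' => ?_
  have ht' : 0 < 1 + t := by linarith
  have hmem : (1 + t)⁻¹ • c' + (t / (1 + t)) • c ∈ C :=
    hC hc' hc (by positivity) (by positivity) (by field_simp)
  calc (1 + t) * infDist y C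
      ≤ (1 + t) * dist y ((1 + t)⁻¹ • c' + (t / (1 + t)) • c) := by
        gcongr; exact infDist_le_dist_of_mem hmem
    _ = ‖(1 + t) • (y - ((1 + t)⁻¹ • c' + (t / (1 + t)) • c))‖ := by
        rw [norm_smul, Real.norm_of_nonneg ht'.le, dist_eq_norm]
    _ = dist (y + t • (y - c)) c' := by
        rw [dist_eq_norm]
        congr 1
        rw [smul_sub, smul_add, smul_smul, smul_smul, mul_inv_cancel₀ ht'.ne',
          mul_div_cancel₀ _ ht'.ne']
        module

theorem Convex.exists_infDist_add_le {Y : Type*} [SeminormedAddCommGroup Y]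
    [NormedSpace ℝ Y] {C : Set Y} (hC : Convex ℝ C) (hne : C.Nonempty) {y : Y}
    (hy : 0 < infDist y C) {s ρ : ℝ} (hs : 0 < s) (hsρ : s < ρ) :
    ∃ y', dist y' y ≤ ρ ∧ infDist y C + s ≤ infDist y' C := by
  have hlt : infDist y C < ρ * infDist y C / s := by
    rw [lt_div_iff₀ hs]; nlinarith
  obtain ⟨c, hc, hcd⟩ := (infDist_lt_iff hne).1 hlt
  have hpos : 0 < dist y c := hy.trans_le (infDist_le_dist_of_mem hc)
  have ht : 0 ≤ ρ / dist y c := div_nonneg (hs.trans hsρ).le hpos.le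
  refine ⟨y + (ρ / dist y c) • (y - c), ?_, le_trans ?_
    (hC.infDist_le_infDist_add_smul_sub hc y ht)⟩
  · rw [dist_self_add_left, norm_smul, Real.norm_of_nonneg ht, ← dist_eq_norm,
      div_mul_cancel₀ _ hpos.ne']
  · have : s ≤ ρ / dist y c * infDist y C := by
      rw [div_mul_eq_mul_div, le_div_iff₀ hpos, mul_comm]
      exact ((lt_div_iff₀ hs).1 hcd).le
    linarith

theorem IsClosedConvexCone.add_mem {Y : Type*} [SeminormedAddCommGroup Y] [NormedSpace ℝ Y]
    {C : Set Y} (hC : IsClosedConvexCone C) {a b : Y} (ha : a ∈ C) (hb : b ∈ C) : a + b ∈ C := by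
  have h := hC.2.2.2 _ (hC.2.1 ha hb (by norm_num : (0 : ℝ) ≤ 1 / 2)
    (by norm_num : (0 : ℝ) ≤ 1 / 2) (by norm_num)) 2 zero_le_two
  rw [smul_add, smul_smul, smul_smul] at h
  norm_num at h
  exact h

theorem IsClosedConvexCone.infEDist_add_le {Y : Type*} [SeminormedAddCommGroup Y]
    [NormedSpace ℝ Y] {C : Set Y} (hC : IsClosedConvexCone C) (a : Y) {c : Y} (hc : c ∈ C) :
    infEDist (a + c) C ≤ infEDist a C :=
  le_infEDist.2 fun b hb =>
    (infEDist_le_edist_of_mem (hC.add_mem hb hc)).trans_eq (edist_add_right a b c)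

theorem IsClosedConvexCone.infEDist_le_excess_add {Y : Type*} [SeminormedAddCommGroup Y]
    [NormedSpace ℝ Y] {C : Set Y} (hC : IsClosedConvexCone C) {A : Set Y} {r : ℝ} {y : Y}
    (hy : y ∈ cthickening r (A + C)) : infEDist y C ≤ excess A C + ENNReal.ofReal r := by
  suffices h : infEDist y C - excess A C ≤ infEDist y (A + C) from
    tsub_le_iff_left.1 (h.trans hy)
  refine le_infEDist.2 ?_
  rintro _ ⟨a, ha, c, hc, rfl⟩
  refine tsub_le_iff_left.2 (infEDist_le_infEDist_add_edist (y := a + c).trans ?_)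
  gcongr
  exact (hC.infEDist_add_le a hc).trans (infEDist_le_excess C ha)

/-- If every point at radius `ρ` from `B` is controlled by the excess of `A` enlarged by `r`, then
the excess of `B` drops by `ρ - r`. -/
theorem IsClosedConvexCone.excess_le_of_cthickening_subset {Y : Type*} [SeminormedAddCommGroup Y]
    [NormedSpace ℝ Y] {C : Set Y} (hC : IsClosedConvexCone C) {A B : Set Y} {r ρ : ℝ}
    (hr : 0 ≤ r) (hρ : 0 < ρ) (hA : excess A C ≠ ⊤) (hle : ρ - r ≤ (excess A C).toReal)
    (hsub : cthickening ρ B ⊆ cthickening r (A + C)) :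
    excess B C ≤ ENNReal.ofReal ((excess A C).toReal - (ρ - r)) := by
  have hne : C.Nonempty := ⟨0, hC.2.2.1⟩
  refine iSup₂_le fun y hy => ?_
  change infEDist y C ≤ _
  rw [← ENNReal.ofReal_toReal (infEDist_ne_top hne : infEDist y C ≠ ⊤)]
  refine ENNReal.ofReal_le_ofReal ?_
  change infDist y C ≤ (excess A C).toReal - (ρ - r)
  rcases (infDist_nonneg (x := y) (s := C)).eq_or_lt with h0 | hpos
  · rw [← h0]; linarith
  have key : ∀ s, 0 < s → s < ρ → infDist y C + s ≤ (excess A C).toReal + r := by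
    intro s hs hsρ
    obtain ⟨y', hy', hle'⟩ := hC.2.1.exists_infDist_add_le hne hpos hs hsρ
    have hmem : y' ∈ cthickening r (A + C) :=
      hsub (mem_cthickening_of_dist_le y' y ρ B hy hy')
    have h := ENNReal.toReal_mono (by simp [hA]) (hC.infEDist_le_excess_add hmem)
    rw [ENNReal.toReal_add hA ENNReal.ofReal_ne_top, ENNReal.toReal_ofReal hr] at h
    exact hle'.trans h
  by_contra! hcon
  have := key (max (ρ / 2) ((ρ + ((excess A C).toReal + r - infDist y C)) / 2))
    (lt_max_of_lt_left (by linarith)) (max_lt (by linarith) (by linarith))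
  linarith [le_max_right (ρ / 2) ((ρ + ((excess A C).toReal + r - infDist y C)) / 2)]

theorem IsIncBoundAt.exists_excess_add_le {X Y : Type*} [PseudoMetricSpace X]
    [SeminormedAddCommGroup Y] [NormedSpace ℝ Y] {G : X → Set Y} {C : Set Y}
    (hC : IsClosedConvexCone C) {x : X} {a α : ℝ} (ha : IsIncBoundAt G C x a)
    (hα : 1 < α) (hαa : α ≤ a) (hx : excess (G x) C ≠ ⊤) (hx0 : excess (G x) C ≠ 0) :
    ∃ u, u ≠ x ∧
      excess (G u) C + ENNReal.ofReal (α - 1) * edist x u ≤ excess (G x) C := by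
  obtain ⟨ha1, δ, hδ, h⟩ := ha
  have he : 0 < (excess (G x) C).toReal := ENNReal.toReal_pos hx0 hx
  have ha1' : 0 < a - 1 := by linarith
  set e := (excess (G x) C).toReal with he_def
  have hr : 0 < min δ (e / (a - 1)) := lt_min hδ (div_pos he ha1')
  have hre : min δ (e / (a - 1)) * (a - 1) ≤ e :=
    (le_div_iff₀ ha1').1 (min_le_right _ _)
  obtain ⟨u, hu, hsub⟩ := h _ hr (min_le_left _ _)
  set r := min δ (e / (a - 1))
  have hexc : excess (G u) C ≤ ENNReal.ofReal (e - (a * r - r)) :=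
    hC.excess_le_of_cthickening_subset hr.le (by nlinarith) hx (by linarith) hsub
  have hgap : 0 < r * (a - 1) := mul_pos hr ha1'
  refine ⟨u, ?_, ?_⟩
  · rintro rfl
    rw [← ENNReal.ofReal_toReal hx, ENNReal.ofReal_le_ofReal_iff (by linarith)] at hexc
    linarith
  · have hd : edist x u ≤ ENNReal.ofReal r := by
      rw [edist_comm, edist_dist]
      exact ENNReal.ofReal_le_ofReal hu
    calc excess (G u) C + ENNReal.ofReal (α - 1) * edist x u
        ≤ ENNReal.ofReal (e - (a * r - r)) + ENNReal.ofReal (α - 1) * ENNReal.ofReal r := by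
          gcongr
      _ = ENNReal.ofReal (e - (a * r - r) + (α - 1) * r) := by
          rw [← ENNReal.ofReal_mul (by linarith), ← ENNReal.ofReal_add (by linarith)
            (mul_nonneg (by linarith) hr.le)]
      _ ≤ ENNReal.ofReal e := ENNReal.ofReal_le_ofReal (by nlinarith)
      _ = excess (G x) C := ENNReal.ofReal_toReal hx

theorem exists_isIncBoundAt_of_lt_alphaFC {P X Y : Type*} [PseudoMetricSpace X]
    [SeminormedAddCommGroup Y] {F : P → X → Set Y} {Cm : P → Set Y} {α : ℝ}
    (hα : ENNReal.ofReal α < alphaFC F Cm) {p : P} {x : X} (hx : ¬ F p x ⊆ Cm p) :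
    ∃ a, IsIncBoundAt (F p) (Cm p) x a ∧ α ≤ a := by
  have h : ENNReal.ofReal α < incBound (F p) (Cm p) x :=
    hα.trans_le (iInf₂_le (f := fun (q : P × X) (_ : q ∈ {q : P × X | ¬ F q.1 q.2 ⊆ Cm q.1}) =>
      incBound (F q.1) (Cm q.1) q.2) (p, x) hx)
  simp only [incBound, lt_iSup_iff] at h
  obtain ⟨a, ha, hlt⟩ := h
  exact ⟨a, ha, (lt_of_not_ge fun hge => hlt.not_ge (ENNReal.ofReal_le_ofReal hge)).le⟩

/-- Global solvability of parameterized set-valued inclusions with the associated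
error bound. -/
theorem stmt7 {P X Y : Type*} [TopologicalSpace P] [MetricSpace X] [CompleteSpace X]
    [NormedAddCommGroup Y] [NormedSpace ℝ Y]
    (F : P → X → Set Y) (Cm : P → Set Y)
    (hF : ∀ p x, (F p x).Nonempty ∧ IsClosed (F p x))
    (hCm : ∀ p, IsClosedConvexCone (Cm p) ∧ ({0} : Set Y) ≠ Cm p ∧ Cm p ≠ Set.univ)
    (hi : ∀ p : P, ∃ xhat : X, excess (F p xhat) (Cm p) ≠ ⊤)
    (hii : ∀ p : P, LscSV (F p))
    (hiii : 1 < alphaFC F Cm) :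
    ∀ α : ℝ, 1 < α → ENNReal.ofReal α < alphaFC F Cm →
      ∀ x₀ : X, ∀ p : P,
        {x : X | F p x ⊆ Cm p}.Nonempty ∧
        EMetric.infEdist x₀ {x : X | F p x ⊆ Cm p} ≤
          excess (F p x₀) (Cm p) / ENNReal.ofReal (α - 1) := by
  intro α hα hlt x₀ p
  obtain ⟨hC, -, -⟩ := hCm p
  have hc : ENNReal.ofReal (α - 1) ≠ 0 := by simpa using hα
  have solve : ∀ x, excess (F p x) (Cm p) ≠ ⊤ → ∃ z, F p z ⊆ Cm p ∧
      ENNReal.ofReal (α - 1) * edist x z ≤ excess (F p x) (Cm p) := by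
    intro x hx
    obtain ⟨z, hz, hmin⟩ :=
      ((hii p).lowerSemicontinuous_excess (Cm p)).exists_ekeland hc ENNReal.ofReal_ne_top hx
    refine ⟨z, ?_, le_add_self.trans hz⟩
    by_contra hzC
    obtain ⟨a, ha, hαa⟩ := exists_isIncBoundAt_of_lt_alphaFC hlt hzC
    obtain ⟨u, hne, hu⟩ := ha.exists_excess_add_le hC hα hαa
      (ne_top_of_le_ne_top hx (le_self_add.trans hz))
      (mt (excess_eq_zero_iff hC.1).1 hzC)
    exact hne (hmin u hu)
  constructor
  · obtain ⟨x, hx⟩ := hi p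
    obtain ⟨z, hz, -⟩ := solve x hx
    exact ⟨z, hz⟩
  · by_cases hx : excess (F p x₀) (Cm p) = ⊤
    · rw [hx, ENNReal.top_div_of_ne_top ENNReal.ofReal_ne_top]
      exact le_top
    obtain ⟨z, hz, hle⟩ := solve x₀ hx
    refine (infEDist_le_edist_of_mem (show z ∈ {x : X | F p x ⊆ Cm p} from hz)).trans ?_
    rw [ENNReal.le_div_iff_mul_le (Or.inl hc) (Or.inl ENNReal.ofReal_ne_top), mul_comm]
    exact hle
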